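/- arXiv:2008.13218 — 2 statements merged into one kernel-verified Lean document; each statement's English description precedes it below -/
import Mathlib

section
/- Let R be a finite ring with unity of characteristic p and Jacobson radical J. Then every maximal subring T of R contains J². Consequently, σ(R) = σ(R/J²). -/
/-- A cover of a ring by proper subrings (subrings need not contain `1`). -/
def IsSubringCover {R : Type*} [Ring R] (C : Finset (NonUnitalSubring R)) : Prop :=
  (∀ S ∈ C, S ≠ ⊤) ∧ ∀ r : R, ∃ S ∈ C, r ∈ S

/-- The covering number of a ring: the least size of a cover by proper subrings,
`⊤` if no (finite) cover exists. -/
noncomputable def ringSigma (R : Type*) [Ring R] : ℕ∞ :=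
  sInf {n : ℕ∞ | ∃ C : Finset (NonUnitalSubring R), IsSubringCover C ∧ (C.card : ℕ∞) = n}

theorem aux_mem {R : Type*} [Ring R] [Finite R] (T : NonUnitalSubring R) (hT : IsCoatom T) :
    ∀ x ∈ Ideal.jacobson (⊥ : Ideal R), ∀ y ∈ Ideal.jacobson (⊥ : Ideal R), x * y ∈ T := by
  set J := Ideal.jacobson (⊥ : Ideal R) with hJ
  have : J.IsTwoSided := by rw [hJ]; infer_instance
  have hnil : IsNilpotent J := by
    exact IsArtinianRing.isNilpotent_jacobson_bot
  obtain ⟨n, hn⟩ := hnil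
  let S : NonUnitalSubring R :=
    { carrier := {r | ∃ t ∈ T, ∃ a ∈ J * J, t + a = r}
      zero_mem' := ⟨0, T.zero_mem, 0, (J * J).zero_mem, by simp⟩
      add_mem' := by
        rintro _ _ ⟨t, ht, a, ha, rfl⟩ ⟨t', ht', a', ha', rfl⟩
        exact ⟨t + t', T.add_mem ht ht', a + a', (J * J).add_mem ha ha', by abel⟩
      neg_mem' := by
        rintro _ ⟨t, ht, a, ha, rfl⟩
        exact ⟨-t, T.neg_mem ht, -a, (J * J).neg_mem ha, by abel⟩
      mul_mem' := by
        rintro _ _ ⟨t, ht, a, ha, rfl⟩ ⟨t', ht', a', ha', rfl⟩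
        exact ⟨t * t', T.mul_mem ht ht', t * a' + a * (t' + a'),
          (J * J).add_mem ((J * J).mul_mem_left _ ha')
            (Ideal.mul_mem_right _ _ ha), by noncomm_ring⟩ }
  have hTS : T ≤ S := fun t ht => ⟨t, ht, 0, (J * J).zero_mem, by simp⟩
  rcases hT.le_iff.1 hTS with h | h
  · have key : ∀ k : ℕ, ∀ x ∈ J, ∃ t ∈ T, ∃ a ∈ J ^ (k + 2), t + a = x := by
      intro k
      induction k with
      | zero =>
        intro x _
        have : x ∈ S := by rw [h]; trivial
        obtain ⟨t, ht, a, ha, e⟩ := this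
        exact ⟨t, ht, a, by
          rw [show 0 + 2 = 1 + 1 from rfl, Submodule.pow_succ, Submodule.pow_one]; exact ha, e⟩
      | succ k ih =>
        have hle : J ^ (k + 2) ≤ J := Ideal.pow_le_self (by omega)
        have h2 : ∀ z ∈ J * J, ∃ t ∈ T, ∃ a ∈ J ^ (k + 1 + 2), t + a = z := by
          intro z hz
          induction hz using Submodule.mul_induction_on' with
          | mem_mul_mem x hx y hy =>
            obtain ⟨t, ht, a, ha, e⟩ := ih x hx
            obtain ⟨t', ht', a', ha', e'⟩ := ih y hy
            have htJ : t ∈ J := by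
              have : t = x - a := by rw [← e]; abel
              rw [this]; exact J.sub_mem hx (hle ha)
            refine ⟨t * t', T.mul_mem ht ht', t * a' + a * y, ?_, ?_⟩
            · refine Ideal.add_mem _ ?_ ?_
              · have : J ^ (k + 1 + 2) = J * J ^ (k + 2) := by
                  exact Ideal.IsTwoSided.pow_succ (n := k + 2)
                rw [this]; exact Ideal.mul_mem_mul htJ ha'
              · have : J ^ (k + 1 + 2) = J ^ (k + 2) * J := by
                  exact Submodule.pow_succ J (n := k + 2)
                rw [this]; exact Ideal.mul_mem_mul ha hy
            · rw [← e, ← e']; noncomm_ring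
          | add x _ y _ hx hy =>
            obtain ⟨t, ht, a, ha, e⟩ := hx
            obtain ⟨t', ht', a', ha', e'⟩ := hy
            exact ⟨t + t', T.add_mem ht ht', a + a', Ideal.add_mem _ ha ha', by
              rw [← e, ← e']; abel⟩
        intro x _
        have : x ∈ S := by rw [h]; trivial
        obtain ⟨t, ht, a, ha, e⟩ := this
        obtain ⟨t', ht', a', ha', e'⟩ := h2 a ha
        exact ⟨t + t', T.add_mem ht ht', a', ha', by rw [← e, ← e']; abel⟩
    have hJT : ∀ x ∈ J, x ∈ T := by
      intro x hx
      obtain ⟨t, ht, a, ha, e⟩ := key n x hx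
      have : a = 0 := by
        have : J ^ (n + 2) = ⊥ := by 
          rw [Submodule.pow_succ, Submodule.pow_succ, hn]; simp
        rw [this] at ha; simpa using ha
      rw [← e, this, add_zero]; exact ht
    intro x hx y hy
    exact T.mul_mem (hJT x hx) (hJT y hy)
  · intro x hx y hy
    rw [← h]
    exact ⟨0, T.zero_mem, x * y, Ideal.mul_mem_mul hx hy, by simp⟩

theorem stmt_8 {R : Type*} [Ring R] [Finite R] (p : ℕ) (hp : p.Prime) [CharP R p]
    (K : TwoSidedIdeal R)
    (hK : (K : Set R) = (AddSubgroup.closure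
      {z : R | ∃ x ∈ Ideal.jacobson (⊥ : Ideal R), ∃ y ∈ Ideal.jacobson (⊥ : Ideal R),
        z = x * y} : Set R)) :
    (∀ T : NonUnitalSubring R, IsCoatom T →
      ∀ x ∈ Ideal.jacobson (⊥ : Ideal R), ∀ y ∈ Ideal.jacobson (⊥ : Ideal R), x * y ∈ T) ∧
      ringSigma R = ringSigma K.ringCon.Quotient := by
  classical
  refine ⟨fun T hT => aux_mem T hT, ?_⟩
  have hKT : ∀ T : NonUnitalSubring R, IsCoatom T → ∀ x ∈ K, x ∈ T := by
    intro T hT x hx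
    have hx' : x ∈ (K : Set R) := hx
    rw [hK] at hx'
    have : AddSubgroup.closure
      {z : R | ∃ x ∈ Ideal.jacobson (⊥ : Ideal R), ∃ y ∈ Ideal.jacobson (⊥ : Ideal R),
        z = x * y} ≤ T.toAddSubgroup := by
      rw [AddSubgroup.closure_le]
      rintro _ ⟨x, hx, y, hy, rfl⟩
      exact aux_mem T hT x hx y hy
    exact this hx'
  let f : R →+* K.ringCon.Quotient := K.ringCon.mk'
  have hf : Function.Surjective f := K.ringCon.mk'_surjective
  have hker : ∀ x y : R, f x = f y → x - y ∈ K := by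
    intro x y h
    exact K.rel_iff x y |>.1 (K.ringCon.eq.1 h)
  have : Finite (NonUnitalSubring R) := Finite.of_injective _ SetLike.coe_injective
  apply le_antisymm
  · apply le_sInf
    rintro _ ⟨C, ⟨hC1, hC2⟩, rfl⟩
    refine le_trans (sInf_le ⟨C.image (NonUnitalSubring.comap f), ⟨?_, ?_⟩, rfl⟩)
      (by exact_mod_cast Finset.card_image_le)
    · intro S hS
      obtain ⟨S', hS', rfl⟩ := Finset.mem_image.1 hS
      intro h
      apply hC1 S' hS'
      rw [eq_top_iff]
      intro y _
      obtain ⟨x, rfl⟩ := hf y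
      have : x ∈ NonUnitalSubring.comap f S' := by rw [h]; trivial
      exact this
    · intro r
      obtain ⟨S, hS, hr⟩ := hC2 (f r)
      exact ⟨_, Finset.mem_image_of_mem _ hS, hr⟩
  · apply le_sInf
    rintro _ ⟨C, ⟨hC1, hC2⟩, rfl⟩
    have hM : ∀ S : NonUnitalSubring R, ∃ M : NonUnitalSubring R,
        S ≠ ⊤ → IsCoatom M ∧ S ≤ M := by
      intro S
      rcases eq_top_or_exists_le_coatom S with h | ⟨M, h⟩
      · exact ⟨⊤, fun h' => absurd h h'⟩
      · exact ⟨M, fun _ => h⟩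
    choose M hM using hM
    refine le_trans (sInf_le ⟨C.image (fun S => NonUnitalSubring.map f (M S)), ⟨?_, ?_⟩, rfl⟩)
      (by exact_mod_cast Finset.card_image_le)
    · intro S hS
      obtain ⟨S', hS', rfl⟩ := Finset.mem_image.1 hS
      obtain ⟨hco, hle⟩ := hM S' (hC1 S' hS')
      intro h
      apply hco.1
      rw [eq_top_iff]
      intro x _
      have : f x ∈ NonUnitalSubring.map f (M S') := by
        have h' : NonUnitalSubring.map f (M S') = ⊤ := h
        rw [h']; trivial
      obtain ⟨m, hm, e⟩ := this
      have hk := hKT _ hco _ (hker x m e.symm)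
      have := (M S').add_mem hk hm
      simpa using this
    · intro r
      obtain ⟨x, rfl⟩ := hf r
      obtain ⟨S, hS, hr⟩ := hC2 x
      exact ⟨_, Finset.mem_image_of_mem _ hS, x, (hM S (hC1 S hS)).2 hr, rfl⟩
end

section
/- Let R be a ring with unity such that σ(R) is finite. Then there exists a two-sided ideal I of R such that R/I is finite, R/I has prime characteristic p, the square of the Jacobson radical of R/I is zero, and σ(R/I) = σ(R). -/
universe u

theorem sigma_le_card {R : Type*} [Ring R] {C : Finset (NonUnitalSubring R)}
    (h : IsSubringCover C) : ringSigma R ≤ C.card :=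
  sInf_le ⟨C, h, rfl⟩

theorem sigma_attained {R : Type*} [Ring R] (h : ringSigma R ≠ ⊤) :
    ∃ C : Finset (NonUnitalSubring R), IsSubringCover C ∧ (C.card : ℕ∞) = ringSigma R := by
  have hne : {n : ℕ∞ | ∃ C : Finset (NonUnitalSubring R),
      IsSubringCover C ∧ (C.card : ℕ∞) = n}.Nonempty := by
    by_contra hc
    rw [Set.not_nonempty_iff_eq_empty] at hc
    apply h
    rw [ringSigma, hc, sInf_empty]
  exact csInf_mem hne

theorem sigma_le_of_surj {R S : Type*} [Ring R] [Ring S] (f : R →+* S)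
    (hf : Function.Surjective f) : ringSigma R ≤ ringSigma S := by
  classical
  apply le_sInf
  rintro n ⟨C, hC, rfl⟩
  have hcov : IsSubringCover (C.image (fun T => T.comap (f : R →ₙ+* S))) := by
    constructor
    · intro T hT
      obtain ⟨T', hT', rfl⟩ := Finset.mem_image.1 hT
      intro htop
      apply hC.1 T' hT'
      rw [eq_top_iff]
      intro s _
      obtain ⟨r, rfl⟩ := hf s
      have : r ∈ T'.comap (f : R →ₙ+* S) := by rw [htop]; trivial
      exact this
    · intro r
      obtain ⟨T, hT, hr⟩ := hC.2 (f r)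
      exact ⟨_, Finset.mem_image_of_mem _ hT, hr⟩
  refine (sigma_le_card hcov).trans ?_
  exact_mod_cast Finset.card_image_le

theorem sigma_le_of_ker {R S : Type*} [Ring R] [Ring S] (f : R →+* S)
    (hf : Function.Surjective f) {C : Finset (NonUnitalSubring R)} (hC : IsSubringCover C)
    (hk : ∀ T ∈ C, ∀ x, f x = 0 → x ∈ T) : ringSigma S ≤ C.card := by
  classical
  have hcov : IsSubringCover (C.image (fun T => T.map (f : R →ₙ+* S))) := by
    constructor
    · intro T hT
      obtain ⟨T', hT', rfl⟩ := Finset.mem_image.1 hT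
      intro htop
      apply hC.1 T' hT'
      rw [eq_top_iff]
      intro s _
      have : f s ∈ T'.map (f : R →ₙ+* S) := by rw [htop]; trivial
      obtain ⟨t, ht, hts⟩ := this
      have hts' : f t = f s := hts
      have := hk T' hT' (s - t) (by rw [map_sub, hts', sub_self])
      have h2 := T'.add_mem this ht
      rwa [sub_add_cancel] at h2
    · intro s
      obtain ⟨r, rfl⟩ := hf s
      obtain ⟨T, hT, hr⟩ := hC.2 r
      exact ⟨_, Finset.mem_image_of_mem _ hT, ⟨r, hr, rfl⟩⟩
  refine (sigma_le_card hcov).trans ?_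
  exact_mod_cast Finset.card_image_le

theorem sigma_eq_of_equiv {R S : Type*} [Ring R] [Ring S] (e : R ≃+* S) :
    ringSigma R = ringSigma S :=
  le_antisymm (sigma_le_of_surj (e : R →+* S) e.surjective)
    (sigma_le_of_surj (e.symm : S →+* R) e.symm.surjective)

theorem sigma_quot {R : Type*} [Ring R] (I : Ideal R) [I.IsTwoSided]
    {C : Finset (NonUnitalSubring R)} (hC : IsSubringCover C)
    (hle : (C.card : ℕ∞) ≤ ringSigma R)
    (hk : ∀ T ∈ C, ∀ x ∈ I, x ∈ T) : ringSigma (R ⧸ I) = ringSigma R := by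
  apply le_antisymm
  · exact (sigma_le_of_ker (Ideal.Quotient.mk I) Ideal.Quotient.mk_surjective hC
      (fun T hT x hx => hk T hT x (Ideal.Quotient.eq_zero_iff_mem.1 hx))).trans hle
  · exact sigma_le_of_surj _ Ideal.Quotient.mk_surjective

theorem nontrivial_of_sigma {R : Type*} [Ring R] (h : ringSigma R ≠ ⊤) : Nontrivial R := by
  by_contra hn
  rw [not_nontrivial_iff_subsingleton] at hn
  obtain ⟨C, hC, -⟩ := sigma_attained h
  obtain ⟨S, hS, -⟩ := hC.2 0
  apply hC.1 S hS
  rw [eq_top_iff]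
  intro x _
  rw [Subsingleton.elim x 0]
  exact S.zero_mem

/-! ### Reduction to finite rings -/

theorem finiteIndex_comap {A : Type*} [AddCommGroup A] (H : AddSubgroup A) [H.FiniteIndex]
    (f : A →+ A) : (H.comap f).FiniteIndex := by
  constructor
  rw [AddSubgroup.index_comap]
  intro h0
  exact AddSubgroup.FiniteIndex.index_ne_zero (H := H)
    (Nat.eq_zero_of_zero_dvd (h0 ▸ AddSubgroup.relIndex_dvd_index_of_normal H f.range))

/-- `{x | ∀ r, x * r ∈ S}` -/
def rightCore {R : Type*} [Ring R] (S : AddSubgroup R) : AddSubgroup R where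
  carrier := {x | ∀ r, x * r ∈ S}
  zero_mem' := fun r => by rw [zero_mul]; exact S.zero_mem
  add_mem' := fun ha hb r => by rw [add_mul]; exact S.add_mem (ha r) (hb r)
  neg_mem' := fun ha r => by rw [neg_mul]; exact S.neg_mem (ha r)

/-- `{x | ∀ r, r * x ∈ S}` -/
def leftCore {R : Type*} [Ring R] (S : AddSubgroup R) : AddSubgroup R where
  carrier := {x | ∀ r, r * x ∈ S}
  zero_mem' := fun r => by rw [mul_zero]; exact S.zero_mem
  add_mem' := fun ha hb r => by rw [mul_add]; exact S.add_mem (ha r) (hb r)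
  neg_mem' := fun ha r => by rw [mul_neg]; exact S.neg_mem (ha r)

theorem rightCore_fi {R : Type*} [Ring R] (S : AddSubgroup R) [S.FiniteIndex]
    (hS : ∀ a ∈ S, ∀ b ∈ S, a * b ∈ S) : (rightCore S).FiniteIndex := by
  have h1 : (⨅ q : R ⧸ S, S.comap (AddMonoidHom.mulRight q.out)).FiniteIndex :=
    AddSubgroup.finiteIndex_iInf fun q => finiteIndex_comap S _
  have h2 : (S ⊓ ⨅ q : R ⧸ S, S.comap (AddMonoidHom.mulRight q.out)).FiniteIndex := inferInstance
  refine AddSubgroup.finiteIndex_of_le (H := S ⊓ ⨅ q : R ⧸ S, S.comap (AddMonoidHom.mulRight q.out)) ?_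
  rintro x ⟨hx, hx2⟩ r
  have h3 : x * (QuotientAddGroup.mk r : R ⧸ S).out ∈ S := by
    have := (AddSubgroup.mem_iInf.1 hx2) (QuotientAddGroup.mk r : R ⧸ S)
    simpa using this
  have h4 : - (QuotientAddGroup.mk r : R ⧸ S).out + r ∈ S :=
    QuotientAddGroup.eq.1 (by simp)
  have h5 := S.add_mem h3 (hS x hx _ h4)
  rw [← mul_add, add_neg_cancel_left] at h5
  exact h5

theorem leftCore_fi {R : Type*} [Ring R] (S : AddSubgroup R) [S.FiniteIndex]
    (hS : ∀ a ∈ S, ∀ b ∈ S, a * b ∈ S) : (leftCore S).FiniteIndex := by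
  have h1 : (⨅ q : R ⧸ S, S.comap (AddMonoidHom.mulLeft q.out)).FiniteIndex :=
    AddSubgroup.finiteIndex_iInf fun q => finiteIndex_comap S _
  have h2 : (S ⊓ ⨅ q : R ⧸ S, S.comap (AddMonoidHom.mulLeft q.out)).FiniteIndex := inferInstance
  refine AddSubgroup.finiteIndex_of_le (H := S ⊓ ⨅ q : R ⧸ S, S.comap (AddMonoidHom.mulLeft q.out)) ?_
  rintro x ⟨hx, hx2⟩ r
  have h3 : (QuotientAddGroup.mk r : R ⧸ S).out * x ∈ S := by
    have := (AddSubgroup.mem_iInf.1 hx2) (QuotientAddGroup.mk r : R ⧸ S)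
    simpa using this
  have h4 : - (QuotientAddGroup.mk r : R ⧸ S).out + r ∈ S :=
    QuotientAddGroup.eq.1 (by simp)
  have h5 := S.add_mem h3 (hS _ h4 x hx)
  rw [← add_mul, add_neg_cancel_left] at h5
  exact h5

/-- The largest two-sided ideal contained in all members of `C`. -/
def coreIdeal {R : Type*} [Ring R] (C : Finset (NonUnitalSubring R)) : Ideal R where
  carrier := {x | ∀ S ∈ C, ∀ a b, a * x * b ∈ S}
  zero_mem' := fun S _ a b => by rw [mul_zero, zero_mul]; exact S.zero_mem
  add_mem' := fun hx hy S hS a b => by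
    rw [mul_add, add_mul]; exact S.add_mem (hx S hS a b) (hy S hS a b)
  smul_mem' := fun c x hx S hS a b => by
    rw [smul_eq_mul, ← mul_assoc]; exact hx S hS _ _

theorem mem_coreIdeal {R : Type*} [Ring R] {C : Finset (NonUnitalSubring R)} {x : R} :
    x ∈ coreIdeal C ↔ ∀ S ∈ C, ∀ a b, a * x * b ∈ S := Iff.rfl

instance {R : Type*} [Ring R] (C : Finset (NonUnitalSubring R)) :
    (coreIdeal C).IsTwoSided where
  mul_mem_of_left {x} c hx := by
    rw [mem_coreIdeal] at hx ⊢
    intro S hS a b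
    rw [← mul_assoc a, mul_assoc]; exact hx S hS _ _

theorem coreIdeal_fi {R : Type*} [Ring R] (C : Finset (NonUnitalSubring R))
    (hC : ∀ S ∈ C, S.toAddSubgroup.FiniteIndex) :
    Finite (R ⧸ coreIdeal C) := by
  have h1 : (⨅ S ∈ C, leftCore (rightCore S.toAddSubgroup)).FiniteIndex := by
    apply AddSubgroup.finiteIndex_iInf'
    intro S hS
    have := hC S hS
    have h2 : (rightCore S.toAddSubgroup).FiniteIndex :=
      rightCore_fi _ (fun a ha b hb => S.mul_mem ha hb)
    apply leftCore_fi
    intro a ha b hb r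
    rw [mul_assoc]
    exact ha _
  have h3 : ((coreIdeal C).toAddSubgroup).FiniteIndex := by
    refine AddSubgroup.finiteIndex_of_le (H := ⨅ S ∈ C, leftCore (rightCore S.toAddSubgroup)) ?_
    intro x hx
    change x ∈ coreIdeal C
    rw [mem_coreIdeal]
    intro S hS a b
    have := (AddSubgroup.mem_iInf.1 (AddSubgroup.mem_iInf.1 hx S)) hS
    exact this a b
  exact AddSubgroup.finite_quotient_of_finiteIndex (H := (coreIdeal C).toAddSubgroup)

open scoped Pointwise in
theorem reduce_finite {R : Type u} [Ring R] (h : ringSigma R ≠ ⊤) :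
    ∃ (S : Type u) (_ : Ring S) (f : R →+* S), Function.Surjective f ∧ Finite S ∧
      ringSigma S = ringSigma R := by
  classical
  obtain ⟨C, hC, hcard⟩ := sigma_attained h
  have hun : ⋃ S ∈ C, ((0 : R) +ᵥ (S.toAddSubgroup : Set R)) = Set.univ := by
    rw [Set.eq_univ_iff_forall]
    intro r
    obtain ⟨S, hS, hr⟩ := hC.2 r
    simp only [Set.mem_iUnion, zero_vadd]
    exact ⟨S, hS, by simpa using hr⟩
  have hun2 := AddSubgroup.leftCoset_cover_filter_FiniteIndex (s := C) (g := fun _ => (0 : R))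
    (H := fun S => S.toAddSubgroup) hun
  set D := C.filter (fun S => S.toAddSubgroup.FiniteIndex) with hD
  have hDC : IsSubringCover D := by
    refine ⟨fun S hS => hC.1 S (Finset.mem_filter.1 hS).1, fun r => ?_⟩
    have := Set.eq_univ_iff_forall.1 hun2 r
    simp only [Set.mem_iUnion, zero_vadd] at this
    obtain ⟨S, hS, hr⟩ := this
    exact ⟨S, hS, by simpa using hr⟩
  refine ⟨R ⧸ coreIdeal D, inferInstance, Ideal.Quotient.mk _, Ideal.Quotient.mk_surjective,
    coreIdeal_fi D (fun S hS => (Finset.mem_filter.1 hS).2), sigma_quot _ hDC ?_ ?_⟩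
  · rw [← hcard]
    exact_mod_cast Finset.card_filter_le _ _
  · intro T hT x hx
    have := mem_coreIdeal.1 hx T hT 1 1
    simpa using this

/-! ### Maximal subrings -/

theorem cover_coatoms {R : Type*} [Ring R] [Finite R] (h : ringSigma R ≠ ⊤) :
    ∃ C : Finset (NonUnitalSubring R), IsSubringCover C ∧ (C.card : ℕ∞) ≤ ringSigma R ∧
      ∀ M ∈ C, IsCoatom M := by
  classical
  obtain ⟨C, hC, hcard⟩ := sigma_attained h
  have : Finite (NonUnitalSubring R) := Finite.of_injective _ SetLike.coe_injective
  have hex : ∀ S : NonUnitalSubring R, ∃ M, S ≠ ⊤ → IsCoatom M ∧ S ≤ M := by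
    intro S
    rcases eq_top_or_exists_le_coatom S with h | ⟨M, hM⟩
    · exact ⟨⊤, fun h' => (h' h).elim⟩
    · exact ⟨M, fun _ => hM⟩
  choose m hm using hex
  have hco : ∀ M ∈ C.image m, IsCoatom M := by
    intro M hM
    obtain ⟨S, hS, rfl⟩ := Finset.mem_image.1 hM
    exact (hm S (hC.1 S hS)).1
  refine ⟨C.image m, ⟨fun M hM => (hco M hM).1, fun r => ?_⟩, ?_, hco⟩
  · obtain ⟨S, hS, hr⟩ := hC.2 r
    exact ⟨m S, Finset.mem_image_of_mem _ hS, (hm S (hC.1 S hS)).2 hr⟩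
  · rw [← hcard]
    exact_mod_cast Finset.card_image_le

/-- The subring `M + K`. -/
def subringAdd {R : Type*} [Ring R] (M : NonUnitalSubring R) (K : Ideal R) [K.IsTwoSided] :
    NonUnitalSubring R where
  carrier := {r | ∃ m ∈ M, r - m ∈ K}
  zero_mem' := ⟨0, M.zero_mem, by simp⟩
  add_mem' := by
    rintro a b ⟨m, hm, ha⟩ ⟨n, hn, hb⟩
    exact ⟨m + n, M.add_mem hm hn, by rw [add_sub_add_comm]; exact K.add_mem ha hb⟩
  neg_mem' := by
    rintro a ⟨m, hm, ha⟩
    exact ⟨-m, M.neg_mem hm, by rw [← neg_sub']; exact K.neg_mem ha⟩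
  mul_mem' := by
    rintro a b ⟨m, hm, ha⟩ ⟨n, hn, hb⟩
    refine ⟨m * n, M.mul_mem hm hn, ?_⟩
    have : a * b - m * n = (a - m) * b + m * (b - n) := by noncomm_ring
    rw [this]
    exact K.add_mem (K.mul_mem_right _ ha) (K.mul_mem_left _ hb)

theorem coatom_dichotomy {R : Type*} [Ring R] {M : NonUnitalSubring R} (hM : IsCoatom M)
    (K : Ideal R) [K.IsTwoSided] :
    (∀ x ∈ K, x ∈ M) ∨ ∀ r, ∃ m ∈ M, r - m ∈ K := by
  have hle : M ≤ subringAdd M K := fun m hm => ⟨m, hm, by simp⟩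
  rcases hM.le_iff.1 hle with h | h
  · right
    intro r
    have : r ∈ subringAdd M K := by rw [h]; trivial
    exact this
  · left
    intro x hx
    rw [← h]
    exact ⟨0, M.zero_mem, by simpa using hx⟩

/-- The ideal `pR`. -/
def pIdeal (R : Type*) [Ring R] (p : ℕ) : Ideal R where
  carrier := {x | ∃ y, x = p • y}
  zero_mem' := ⟨0, by simp⟩
  add_mem' := by
    rintro a b ⟨x, rfl⟩ ⟨y, rfl⟩
    exact ⟨x + y, by rw [smul_add]⟩
  smul_mem' := by
    rintro c x ⟨y, rfl⟩
    exact ⟨c * y, by rw [smul_eq_mul, mul_smul_comm]⟩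

instance (R : Type*) [Ring R] (p : ℕ) : (pIdeal R p).IsTwoSided where
  mul_mem_of_left {x} c hx := by
    obtain ⟨y, rfl⟩ := hx
    exact ⟨y * c, by rw [smul_mul_assoc]⟩

theorem coatom_prime {R : Type*} [Ring R] [Finite R] {M : NonUnitalSubring R}
    (hM : IsCoatom M) : ∃ p : ℕ, p.Prime ∧ ∀ r, p • r ∈ M := by
  by_contra hcon
  push Not at hcon
  have key : ∀ n : ℕ, n ≠ 0 → ∀ r, ∃ m ∈ M, ∃ y, r - m = n • y := by
    intro n
    induction n using induction_on_primes with
    | zero => intro h; exact (h rfl).elim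
    | one => intro _ r; exact ⟨0, M.zero_mem, r, by simp⟩
    | prime_mul p a hp ih =>
      intro hpa r
      have ha : a ≠ 0 := by rintro rfl; simp at hpa
      obtain ⟨m, hm, y, hy⟩ := ih ha r
      rcases coatom_dichotomy hM (pIdeal R p) with h | h
      · obtain ⟨s, hs⟩ := hcon p hp
        exact (hs (h _ ⟨s, rfl⟩)).elim
      · obtain ⟨m', hm', z, hz⟩ := h y
        refine ⟨m + a • m', M.add_mem hm (nsmul_mem hm' a), z, ?_⟩
        rw [mul_comm, mul_smul, ← hz, smul_sub, ← hy]
        abel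
  apply hM.1
  rw [eq_top_iff]
  intro r _
  obtain ⟨m, hm, y, hy⟩ := key (Nat.card R) Nat.card_pos.ne' r
  rw [card_nsmul_eq_zero', sub_eq_zero] at hy
  rwa [hy]

theorem single_prime {R : Type*} [Ring R] [Finite R] {C : Finset (NonUnitalSubring R)}
    (hC : IsSubringCover C) (hco : ∀ M ∈ C, IsCoatom M) :
    ∃ p : ℕ, p.Prime ∧ ∃ D ⊆ C, IsSubringCover D ∧ ∀ M ∈ D, ∀ r, p • r ∈ M := by
  classical
  have hex : ∀ M : NonUnitalSubring R, ∃ p : ℕ, p.Prime ∧ (M ∈ C → ∀ r, p • r ∈ M) := by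
    intro M
    by_cases h : M ∈ C
    · obtain ⟨p, hp, h2⟩ := coatom_prime (hco M h)
      exact ⟨p, hp, fun _ => h2⟩
    · exact ⟨2, Nat.prime_two, fun h' => (h h').elim⟩
  choose P hP hPM using hex
  by_contra hcon
  have hr : ∀ p : ℕ, ∃ r : R, p.Prime → ∀ M ∈ C, P M = p → r ∉ M := by
    intro p
    by_contra hn
    push Not at hn
    have hp : p.Prime := (hn 0).1
    apply hcon
    refine ⟨p, hp, C.filter (fun M => P M = p), Finset.filter_subset _ _, ⟨?_, ?_⟩, ?_⟩
    · intro M hM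
      exact hC.1 M (Finset.mem_filter.1 hM).1
    · intro r
      obtain ⟨-, M, hM, h1, h2⟩ := hn r
      exact ⟨M, Finset.mem_filter.2 ⟨hM, h1⟩, h2⟩
    · intro M hM r
      rw [Finset.mem_filter] at hM
      have := hPM M hM.1 r
      rwa [hM.2] at this
  choose r hr using hr
  let Q := C.image P
  have hQ : ∀ p ∈ Q, p.Prime := by
    intro p hp
    obtain ⟨M, -, rfl⟩ := Finset.mem_image.1 hp
    exact hP M
  let N : ℕ → ℕ := fun p => ∏ q ∈ Q.erase p, q
  obtain ⟨M, hM, hmem⟩ := hC.2 (∑ p ∈ Q, N p • r p)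
  have hpQ : P M ∈ Q := Finset.mem_image_of_mem _ hM
  rw [← Finset.add_sum_erase _ _ hpQ] at hmem
  have hrest : ∑ p ∈ Q.erase (P M), N p • r p ∈ M := by
    refine sum_mem fun q hq => ?_
    have hdvd : P M ∣ N q :=
      Finset.dvd_prod_of_mem (fun q => q) (Finset.mem_erase.2 ⟨(Finset.ne_of_mem_erase hq).symm, hpQ⟩)
    obtain ⟨k, hk⟩ := hdvd
    rw [hk, mul_smul]
    exact hPM M hM _
  have h1 : N (P M) • r (P M) ∈ M := by
    have := M.sub_mem hmem hrest
    rwa [add_sub_cancel_right] at this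
  have hcop : Nat.Coprime (N (P M)) (P M) := by
    apply Nat.Coprime.prod_left
    intro q hq
    exact (Nat.coprime_primes (hQ q (Finset.mem_of_mem_erase hq)) (hP M)).2
      (Finset.ne_of_mem_erase hq)
  apply hr (P M) (hP M) M hM rfl
  have hbez : ((N (P M) : ℤ) * (N (P M)).gcdA (P M) + (P M : ℤ) * (N (P M)).gcdB (P M)) = 1 := by
    rw [← Nat.gcd_eq_gcd_ab, hcop]; rfl
  rw [← one_zsmul (r (P M)), ← hbez, add_smul]
  refine M.add_mem ?_ ?_
  · rw [mul_comm, mul_smul, natCast_zsmul]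
    exact zsmul_mem h1 _
  · rw [mul_smul, natCast_zsmul]
    exact hPM M hM _

theorem reduce_prime {R : Type u} [Ring R] [Finite R] (h : ringSigma R ≠ ⊤) :
    ∃ (S : Type u) (_ : Ring S) (f : R →+* S), Function.Surjective f ∧ Finite S ∧
      (∃ p : ℕ, p.Prime ∧ (p : S) = 0) ∧ ringSigma S = ringSigma R := by
  obtain ⟨C, hC, hcard, hco⟩ := cover_coatoms h
  obtain ⟨p, hp, D, hDC, hD, hpD⟩ := single_prime hC hco
  refine ⟨R ⧸ pIdeal R p, inferInstance, Ideal.Quotient.mk _, Ideal.Quotient.mk_surjective,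
    Finite.of_surjective _ (Ideal.Quotient.mk_surjective (I := pIdeal R p)),
    ⟨p, hp, ?_⟩, sigma_quot _ hD ?_ ?_⟩
  · rw [← map_natCast (Ideal.Quotient.mk (pIdeal R p)), Ideal.Quotient.eq_zero_iff_mem]
    exact ⟨1, by simp⟩
  · refine le_trans ?_ hcard
    exact_mod_cast Finset.card_le_card hDC
  · rintro T hT x ⟨y, rfl⟩
    exact hpD T hT y

theorem coatom_jacobson {R : Type*} [Ring R] [Finite R] {M : NonUnitalSubring R}
    (hM : IsCoatom M) : ∀ x ∈ (Ideal.jacobson (⊥ : Ideal R)) ^ 2, x ∈ M := by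
  set J := Ideal.jacobson (⊥ : Ideal R) with hJ
  rcases coatom_dichotomy hM (J ^ 2) with h | h
  · exact h
  exfalso
  have key : ∀ k : ℕ, ∀ x ∈ J ^ (k + 1), ∃ m ∈ M, x - m ∈ J ^ (k + 2) := by
    intro k
    induction k with
    | zero => intro x _; exact h x
    | succ k ih =>
      intro x hx
      rw [Submodule.pow_succ] at hx
      refine Submodule.mul_induction_on hx ?_ ?_
      · intro a ha b hb
        obtain ⟨m, hm, ham⟩ := ih a ha
        obtain ⟨n, hn, hbn⟩ := h b
        refine ⟨m * n, M.mul_mem hm hn, ?_⟩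
        have : a * b - m * n = (a - m) * b + m * (b - n) := by noncomm_ring
        rw [this]
        have hmJ : m ∈ J ^ (k + 1) := by
          have h1 : a - m ∈ J ^ (k + 1) := by
            rw [show k + 2 = (k + 1) + 1 from rfl, Submodule.pow_succ] at ham
            exact Ideal.mul_le_left ham
          have := (J ^ (k + 1)).sub_mem ha h1
          rwa [sub_sub_cancel] at this
        apply Ideal.add_mem
        · rw [show k + 1 + 2 = (k + 2) + 1 from rfl, Submodule.pow_succ]
          exact Ideal.mul_mem_mul ham hb
        · rw [Ideal.IsTwoSided.pow_add (k + 1) 2]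
          exact Ideal.mul_mem_mul hmJ hbn
      · rintro x y ⟨m, hm, hx⟩ ⟨n, hn, hy⟩
        exact ⟨m + n, M.add_mem hm hn, by rw [add_sub_add_comm]; exact Ideal.add_mem _ hx hy⟩
  have key2 : ∀ k : ℕ, ∀ r, ∃ m ∈ M, r - m ∈ J ^ (k + 2) := by
    intro k
    induction k with
    | zero => exact h
    | succ k ih =>
      intro r
      obtain ⟨m, hm, h1⟩ := ih r
      obtain ⟨n, hn, h2⟩ := key (k + 1) _ h1
      exact ⟨m + n, M.add_mem hm hn, by rw [← sub_sub]; exact h2⟩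
  obtain ⟨n, hn⟩ := IsArtinianRing.isNilpotent_jacobson_bot (R := R)
  apply hM.1
  rw [eq_top_iff]
  intro r _
  obtain ⟨m, hm, h1⟩ := key2 n r
  have h0 : J ^ (n + 2) = ⊥ := by
    rw [Ideal.IsTwoSided.pow_add n 2, hn]
    simp
  rw [h0, Ideal.mem_bot, sub_eq_zero] at h1
  rwa [h1]

theorem reduce_jacobson {R : Type u} [Ring R] [Finite R] (h : ringSigma R ≠ ⊤) :
    ∃ (S : Type u) (_ : Ring S) (f : R →+* S), Function.Surjective f ∧ Finite S ∧
      (∀ x ∈ Ideal.jacobson (⊥ : Ideal S), ∀ y ∈ Ideal.jacobson (⊥ : Ideal S), x * y = 0) ∧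
      ringSigma S = ringSigma R := by
  obtain ⟨C, hC, hcard, hco⟩ := cover_coatoms h
  set J := Ideal.jacobson (⊥ : Ideal R) with hJ
  have hsq : J ^ 2 = J * J := by
    rw [show 2 = 1 + 1 from rfl, Submodule.pow_succ, Submodule.pow_one]
  have hlift : ∀ a : R, Ideal.Quotient.mk (J ^ 2) a ∈ Ideal.jacobson (⊥ : Ideal (R ⧸ J ^ 2)) →
      a ∈ J := by
    intro a ha
    rw [← Ideal.mem_comap, Ideal.comap_jacobson_of_surjective Ideal.Quotient.mk_surjective,
      ← RingHom.ker_eq_comap_bot, Ideal.mk_ker] at ha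
    have h2 : J ^ 2 ≤ J := by
      rw [hsq]; exact Ideal.mul_le_left
    have := Ideal.jacobson_mono h2 ha
    rwa [hJ, Ideal.jacobson_idem] at this
  refine ⟨R ⧸ J ^ 2, inferInstance, Ideal.Quotient.mk _, Ideal.Quotient.mk_surjective,
    Finite.of_surjective _ (Ideal.Quotient.mk_surjective (I := J ^ 2)),
    ?_, sigma_quot _ hC hcard (fun M hM => coatom_jacobson (hco M hM))⟩
  intro x hx y hy
  obtain ⟨a, rfl⟩ := Ideal.Quotient.mk_surjective x
  obtain ⟨b, rfl⟩ := Ideal.Quotient.mk_surjective y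
  rw [← map_mul, Ideal.Quotient.eq_zero_iff_mem, hsq]
  exact Ideal.mul_mem_mul (hlift a hx) (hlift b hy)

/-- If `σ(R)` is finite, then there is a two-sided ideal `I` such that `R/I` is
finite, of prime characteristic, with Jacobson radical of square zero, and
`σ(R/I) = σ(R)`. -/
theorem stmt_9 {R : Type*} [Ring R] (hfin : ringSigma R ≠ ⊤) :
    ∃ I : TwoSidedIdeal R, Finite I.ringCon.Quotient ∧
      (∃ p : ℕ, p.Prime ∧ CharP I.ringCon.Quotient p) ∧
      (∀ x ∈ Ideal.jacobson (⊥ : Ideal I.ringCon.Quotient),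
        ∀ y ∈ Ideal.jacobson (⊥ : Ideal I.ringCon.Quotient), x * y = 0) ∧
      ringSigma I.ringCon.Quotient = ringSigma R := by
  obtain ⟨S₁, _, f₁, hf₁, _, h₁⟩ := reduce_finite hfin
  obtain ⟨S₂, _, f₂, hf₂, _, ⟨p, hp, hp0⟩, h₂⟩ := reduce_prime (h₁.trans_ne hfin)
  obtain ⟨S₃, _, f₃, hf₃, _, hJ, h₃⟩ := reduce_jacobson ((h₂.trans h₁).trans_ne hfin)
  let f : R →+* S₃ := f₃.comp (f₂.comp f₁)
  have hf : Function.Surjective f := hf₃.comp (hf₂.comp hf₁)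
  let I : TwoSidedIdeal R := TwoSidedIdeal.ker f
  let e : I.ringCon.Quotient ≃+* S₃ := RingCon.quotientKerEquivOfSurjective f hf
  have hs : ringSigma I.ringCon.Quotient = ringSigma R :=
    (sigma_eq_of_equiv e).trans (h₃.trans (h₂.trans h₁))
  refine ⟨I, Finite.of_equiv _ e.symm.toEquiv, ⟨p, hp, ?_⟩, ?_, hs⟩
  · have : Nontrivial I.ringCon.Quotient := nontrivial_of_sigma (hs.trans_ne hfin)
    have hz : (p : I.ringCon.Quotient) = 0 := by
      apply e.injective
      rw [map_natCast, map_zero, ← map_natCast f₃, hp0, map_zero]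
    exact (CharP.charP_iff_prime_eq_zero hp).2 hz
  · have hm : ∀ x ∈ Ideal.jacobson (⊥ : Ideal I.ringCon.Quotient),
        e x ∈ Ideal.jacobson (⊥ : Ideal S₃) := by
      intro x hx
      change (e : I.ringCon.Quotient →+* S₃) x ∈ _
      rw [← Ideal.mem_comap, Ideal.comap_jacobson_of_surjective
        (f := (e : I.ringCon.Quotient →+* S₃)) e.surjective]
      exact Ideal.jacobson_mono bot_le hx
    intro x hx y hy
    apply e.injective
    rw [map_mul, map_zero]
    exact hJ _ (hm x hx) _ (hm y hy)
end
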